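/- Let q be a prime power, n a positive integer, g_1, …, g_n ∈ F_{q^n} linearly independent over F_q (so g_1, …, g_n form an F_q-basis of F_{q^n}), and 1 ≤ k ≤ n − 1. Let f(x) = x^{q^{n−1}} + f_{≤k−1}(x), where f_{≤k−1} is a q-linearized polynomial over F_{q^n} of q-degree at most k − 1, and σ_f = (f(g_1), …, f(g_n)). Then d_R(σ_f, G) = n − k, i.e., σ_f is a deep hole of the Gabidulin code G. -/

import Mathlib

def gabidulinCode (q : ℕ) {F : Type} [Field F] {n : ℕ} (g : Fin n → F) (k : ℕ) :
    Set (Fin n → F) :=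
  {c | ∃ v : Fin k → F, c = fun j => ∑ i : Fin k, v i * g j ^ q ^ (i : ℕ)}

noncomputable def rankDistTo (Fq : Type) [Field Fq] {F : Type} [Field F] [Algebra Fq F]
    {n : ℕ} (u : Fin n → F) (G : Set (Fin n → F)) : ℕ :=
  sInf {r : ℕ | ∃ c ∈ G, r = Module.finrank Fq (Submodule.span Fq (Set.range (u - c)))}

open Polynomial in
/-- The polynomial `∑ i, v i * X ^ q ^ i`. -/
noncomputable def linearizedPolynomial (q : ℕ) {F : Type} [Field F] {m : ℕ} (v : Fin m → F) :
    F[X] :=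
  ∑ i : Fin m, C (v i) * X ^ q ^ (i : ℕ)

open Polynomial in
theorem linearizedPolynomial_ne_zero {q : ℕ} (hq : 1 < q) {F : Type} [Field F] {m : ℕ}
    {v : Fin m → F} (hv : v ≠ 0) : linearizedPolynomial q v ≠ 0 := by
  obtain ⟨i, hi⟩ := Function.ne_iff.mp hv
  intro h
  apply hi
  have hc := congrArg (fun p : F[X] => p.coeff (q ^ (i : ℕ))) h
  simpa [linearizedPolynomial, coeff_X_pow, Nat.pow_right_inj hq, Fin.val_inj] using hc

open Polynomial in
theorem natDegree_linearizedPolynomial_lt {q : ℕ} (hq : 1 < q) {F : Type} [Field F] {m : ℕ}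
    {v : Fin m → F} (hv : v ≠ 0) : (linearizedPolynomial q v).natDegree < q ^ m := by
  rw [natDegree_lt_iff_degree_lt (linearizedPolynomial_ne_zero hq hv)]
  refine (degree_sum_le _ _).trans_lt ((Finset.sup_lt_iff (WithBot.bot_lt_coe _)).mpr ?_)
  intro i _
  refine (degree_C_mul_X_pow_le _ _).trans_lt ?_
  exact_mod_cast Nat.pow_lt_pow_right hq i.isLt

/-- The `Fq`-linear map `x ↦ ∑ i, v i * x ^ q ^ i`, where `q` is the cardinality of `Fq`. -/
noncomputable def linearizedMap (Fq : Type) [Field Fq] [Fintype Fq] {F : Type} [Field F]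
    [Algebra Fq F] {m : ℕ} (v : Fin m → F) : F →ₗ[Fq] F :=
  ∑ i : Fin m, v i • (FiniteField.frobeniusAlgHom Fq F ^ (i : ℕ)).toLinearMap

theorem frobeniusAlgHom_pow_apply (Fq : Type) [Field Fq] [Fintype Fq] {F : Type} [Field F]
    [Algebra Fq F] (i : ℕ) (x : F) :
    (FiniteField.frobeniusAlgHom Fq F ^ i) x = x ^ Fintype.card Fq ^ i := by
  rw [AlgHom.coe_pow, FiniteField.coe_frobeniusAlgHom, pow_iterate]

theorem linearizedMap_apply (Fq : Type) [Field Fq] [Fintype Fq] {F : Type} [Field F]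
    [Algebra Fq F] {m : ℕ} (v : Fin m → F) (x : F) :
    linearizedMap Fq v x = ∑ i : Fin m, v i * x ^ Fintype.card Fq ^ (i : ℕ) := by
  simp only [linearizedMap, LinearMap.sum_apply, LinearMap.smul_apply, AlgHom.toLinearMap_apply,
    frobeniusAlgHom_pow_apply, smul_eq_mul]

open Polynomial in
/-- A nonzero linearized polynomial of `q`-degree less than `m` has fewer than `q ^ m` roots. -/
theorem finrank_ker_linearizedMap_lt {Fq : Type} [Field Fq] [Fintype Fq] {F : Type} [Field F]
    [Fintype F] [Algebra Fq F] {m : ℕ} {v : Fin m → F} (hv : v ≠ 0) :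
    Module.finrank Fq (linearizedMap Fq v).ker < m := by
  classical
  have hq : 1 < Fintype.card Fq := Fintype.one_lt_card
  set p := linearizedPolynomial (Fintype.card Fq) v
  have hp : p ≠ 0 := linearizedPolynomial_ne_zero hq hv
  have hsub : ((linearizedMap Fq v).ker : Set F).toFinset ⊆ p.roots.toFinset := by
    intro x hx
    rw [Multiset.mem_toFinset, mem_roots hp, IsRoot.def]
    simpa [p, linearizedPolynomial, eval_finsetSum, linearizedMap_apply] using hx
  have hcard : Fintype.card (linearizedMap Fq v).ker < Fintype.card Fq ^ m := by
    calc
      Fintype.card (linearizedMap Fq v).ker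
          = ((linearizedMap Fq v).ker : Set F).toFinset.card := (Set.toFinset_card _).symm
      _ ≤ p.roots.toFinset.card := Finset.card_le_card hsub
      _ ≤ p.roots.card := Multiset.toFinset_card_le _
      _ ≤ p.natDegree := card_roots' p
      _ < Fintype.card Fq ^ m := natDegree_linearizedPolynomial_lt hq hv
  rw [Module.card_eq_pow_finrank (K := Fq)] at hcard
  exact (Nat.pow_lt_pow_iff_right hq).mp hcard

/-- Linearized polynomials of `q`-degree less than `k` interpolate arbitrary values at `k`
points that are linearly independent over `Fq`. -/
theorem exists_linearizedMap_interpolate {Fq : Type} [Field Fq] [Fintype Fq] {F : Type} [Field F]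
    [Fintype F] [Algebra Fq F] {k : ℕ} {b : Fin k → F} (hb : LinearIndependent Fq b)
    (y : Fin k → F) : ∃ v : Fin k → F, ∀ j, linearizedMap Fq v (b j) = y j := by
  let T : (Fin k → F) →ₗ[F] (Fin k → F) :=
    (Matrix.of fun j i : Fin k => b j ^ Fintype.card Fq ^ (i : ℕ)).mulVecLin
  have hT (v j) : T v j = linearizedMap Fq v (b j) := by
    simp [T, Matrix.mulVec, dotProduct, linearizedMap_apply, mul_comm]
  have hinj : Function.Injective T := by
    rw [← LinearMap.ker_eq_bot, LinearMap.ker_eq_bot']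
    intro v hv
    by_contra hne
    have hle : Submodule.span Fq (Set.range b) ≤ (linearizedMap Fq v).ker := by
      rw [Submodule.span_le]
      rintro _ ⟨j, rfl⟩
      simp [← hT, hv]
    have := Submodule.finrank_mono hle
    rw [finrank_span_eq_card hb, Fintype.card_fin] at this
    exact absurd (finrank_ker_linearizedMap_lt hne) (not_lt.mpr this)
  obtain ⟨v, hv⟩ := LinearMap.injective_iff_surjective.mp hinj y
  exact ⟨v, fun j => by rw [← hT, hv]⟩

/-- On an extension of degree `n`, a linearized polynomial with leading term `x ^ q ^ (n - 1)` and
all other terms of `q`-degree less than `k` has at most `q ^ k` roots: its `q`-th power agrees with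
a linearized polynomial of `q`-degree at most `k` whose linear coefficient is `1`. -/
theorem finrank_ker_frobenius_pow_sub_le {Fq : Type} [Field Fq] [Fintype Fq] {F : Type} [Field F]
    [Fintype F] [Algebra Fq F] {n k : ℕ} (hn : 0 < n)
    (hcard : Fintype.card F = Fintype.card Fq ^ n) (v : Fin k → F) :
    Module.finrank Fq
      ((FiniteField.frobeniusAlgHom Fq F ^ (n - 1)).toLinearMap - linearizedMap Fq v).ker ≤ k := by
  let w : Fin (k + 1) → F := Fin.cons 1 fun i => -(v i ^ Fintype.card Fq)
  have hw : w ≠ 0 := fun h => one_ne_zero (α := F) (congrFun h 0)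
  refine (Submodule.finrank_mono ?_).trans (Nat.lt_succ_iff.mp (finrank_ker_linearizedMap_lt hw))
  intro x hx
  have hx' : x ^ Fintype.card Fq ^ (n - 1) = linearizedMap Fq v x := by
    simpa [frobeniusAlgHom_pow_apply, sub_eq_zero] using hx
  have hpow := congrArg (FiniteField.frobeniusAlgHom Fq F) hx'
  rw [linearizedMap_apply, map_sum] at hpow
  simp only [FiniteField.coe_frobeniusAlgHom, mul_pow, ← pow_mul, ← pow_succ,
    Nat.sub_add_cancel hn, ← hcard, FiniteField.pow_card] at hpow
  rw [LinearMap.mem_ker, linearizedMap_apply, Fin.sum_univ_succ]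
  simp only [w, Fin.cons_zero, Fin.cons_succ, Fin.val_zero, Fin.val_succ, pow_zero, pow_one,
    one_mul, neg_mul, Finset.sum_neg_distrib]
  rw [← hpow, add_neg_cancel]

/-- A word vanishing on its first `k` coordinates has rank at most `n - k`. -/
theorem finrank_span_range_le_sub {K V : Type} [Field K] [AddCommGroup V] [Module K V]
    {n k : ℕ} (hkn : k ≤ n) (u : Fin n → V) (hu : ∀ j : Fin k, u (Fin.castLE hkn j) = 0) :
    Module.finrank K (Submodule.span K (Set.range u)) ≤ n - k := by
  let t : Fin (n - k) → V := fun j => u ⟨k + j, by omega⟩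
  have hle : Submodule.span K (Set.range u) ≤ Submodule.span K (Set.range t) := by
    rw [Submodule.span_le]
    rintro _ ⟨j, rfl⟩
    by_cases hj : (j : ℕ) < k
    · have h0 : u j = 0 := hu ⟨j, hj⟩
      simp [h0]
    · refine Submodule.subset_span ⟨⟨j - k, by omega⟩, congrArg u (Fin.ext ?_)⟩
      simp only
      omega
  have : Module.Finite K (Submodule.span K (Set.range t)) :=
    Module.Finite.span_of_finite K (Set.finite_range t)
  simpa using (Submodule.finrank_mono hle).trans (finrank_range_le_card t)

/-- Proposition 4: for the full-length Gabidulin code over `F_{q^n}` (case `m = n`),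
every word `σ_f` with `f(x) = x^{q^{n-1}} + (q-degree ≤ k-1 terms)` is a deep hole,
i.e. `d_R(σ_f, G) = n - k`. -/
theorem deep_hole_x_pow_q_pow_n_sub_one
    (q n k : ℕ) (hq : IsPrimePow q) (hn : 0 < n)
    (Fq F : Type) [Field Fq] [Fintype Fq] [Field F] [Fintype F] [Algebra Fq F]
    (hcardFq : Fintype.card Fq = q) (hcardF : Fintype.card F = q ^ n)
    (g : Fin n → F) (hg : LinearIndependent Fq g)
    (hk : 1 ≤ k) (hkn : k ≤ n - 1)
    (c : Fin k → F)
    (σf : Fin n → F)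
    (hσf : σf = fun j => g j ^ q ^ (n - 1) + ∑ i : Fin k, c i * g j ^ q ^ (i : ℕ)) :
    rankDistTo Fq σf (gabidulinCode q g k) = n - k := by
  subst hcardFq hσf
  have hle : k ≤ n := by omega
  have hlower : ∀ r ∈ {r : ℕ | ∃ d ∈ gabidulinCode (Fintype.card Fq) g k,
      r = Module.finrank Fq (Submodule.span Fq (Set.range ((fun j =>
        g j ^ Fintype.card Fq ^ (n - 1) +
          ∑ i : Fin k, c i * g j ^ Fintype.card Fq ^ (i : ℕ)) - d)))}, n - k ≤ r := by
    rintro _ ⟨_, ⟨v, rfl⟩, rfl⟩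
    have hdim : Module.finrank Fq F = n := by
      rw [Module.card_eq_pow_finrank (K := Fq)] at hcardF
      exact Nat.pow_right_injective Fintype.one_lt_card hcardF
    have hspan : Submodule.span Fq (Set.range g) = ⊤ :=
      hg.span_eq_top_of_card_eq_finrank' (by simp [hdim])
    let h := (FiniteField.frobeniusAlgHom Fq F ^ (n - 1)).toLinearMap - linearizedMap Fq (v - c)
    have hword : ((fun j => g j ^ Fintype.card Fq ^ (n - 1) +
        ∑ i : Fin k, c i * g j ^ Fintype.card Fq ^ (i : ℕ)) -
        fun j => ∑ i : Fin k, v i * g j ^ Fintype.card Fq ^ (i : ℕ)) = h ∘ g := by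
      funext j
      simp [h, frobeniusAlgHom_pow_apply, linearizedMap_apply, sub_mul, Finset.sum_sub_distrib]
      ring
    rw [hword, Set.range_comp, ← Submodule.map_span, hspan, Submodule.map_top]
    have hker : Module.finrank Fq h.ker ≤ k := finrank_ker_frobenius_pow_sub_le hn hcardF (v - c)
    have := h.finrank_range_add_finrank_ker
    omega
  obtain ⟨v, hv⟩ := exists_linearizedMap_interpolate
    (hg.comp (Fin.castLE hle) (Fin.castLE_injective hle)) fun j =>
      g (Fin.castLE hle j) ^ Fintype.card Fq ^ (n - 1)
  have hmem : (fun j => ∑ i : Fin k, (v + c) i * g j ^ Fintype.card Fq ^ (i : ℕ)) ∈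
      gabidulinCode (Fintype.card Fq) g k := ⟨v + c, rfl⟩
  unfold rankDistTo
  refine le_antisymm
    (le_trans (Nat.sInf_le ⟨_, hmem, rfl⟩) (finrank_span_range_le_sub hle _ ?_))
    (le_csInf ⟨_, ⟨_, hmem, rfl⟩⟩ hlower)
  intro j
  have hj := hv j
  rw [linearizedMap_apply] at hj
  simp only [Function.comp_apply] at hj
  simp [add_mul, Finset.sum_add_distrib, hj]
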